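/- Let N ≥ 0 and a ∈ ℝ, and let ℬ_{N+1}(a) be the (N+1)×(N+1) real tridiagonal matrix (indexed 0,…,N) with diagonal entries (ℬ)_{n,n} = −n, superdiagonal entries (ℬ)_{i,i+1} = (i+1)a, and subdiagonal entries (ℬ)_{i,i−1} = (N−i+1)(a−1). Then for every real x, det(x·I_{N+1} + ℬ_{N+1}(a)) = ∏_{j=0}^{N} [x + (N−2j)a − N + j]. -/

import Mathlib

/-- Askey's matrix `ℬ_{M+1}(a)` of size `n = M + 1`: diagonal entries `-i`,
superdiagonal entries `(i + 1) a`, subdiagonal entries `(M - i + 1)(a - 1) = (n - i)(a - 1)`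
(0-indexed). -/
def askeyB (n : ℕ) (a : ℝ) : Matrix (Fin n) (Fin n) ℝ :=
  Matrix.of fun i j =>
    if (j : ℕ) = (i : ℕ) + 1 then ((i : ℕ) + 1 : ℝ) * a
    else if (i : ℕ) = (j : ℕ) + 1 then ((n : ℝ) - (i : ℕ)) * (a - 1)
    else if i = j then -((i : ℕ) : ℝ)
    else 0

/-- The coefficient of `z ^ i` in `(1 - z) ^ k`. -/
def oneSubPowCoeff (i k : ℕ) : ℝ := (-1) ^ i * (k.choose i : ℝ)

/-- The matrix of the basis `(1 - z) ^ k` with respect to the monomials `z ^ i`. -/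
def oneSubPowMatrix (n : ℕ) : Matrix (Fin n) (Fin n) ℝ :=
  Matrix.of fun i k => oneSubPowCoeff i k

/-- The lower bidiagonal matrix to which `x + ℬ` is similar in the basis `(1 - z) ^ k`. -/
def askeyBidiag (N : ℕ) (a x : ℝ) : Matrix (Fin (N + 1)) (Fin (N + 1)) ℝ :=
  Matrix.of fun i k =>
    if (i : ℕ) = k then x + ((N : ℝ) - 2 * ((k : ℕ) : ℝ)) * a - N + ((k : ℕ) : ℝ)
    else if (i : ℕ) = (k : ℕ) + 1 then (((k : ℕ) : ℝ) - N) * (a - 1)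
    else 0

theorem oneSubPowMatrix_det_ne_zero (n : ℕ) : (oneSubPowMatrix n).det ≠ 0 := by
  rw [Matrix.det_of_isUpperTriangular]
  · exact Finset.prod_ne_zero_iff.mpr fun i _ => by simp [oneSubPowMatrix, oneSubPowCoeff]
  · intro i k hik
    have hik' : (k : ℕ) < i := hik
    simp [oneSubPowMatrix, oneSubPowCoeff, Nat.choose_eq_zero_of_lt hik']

theorem askeyBidiag_det (N : ℕ) (a x : ℝ) :
    (askeyBidiag N a x).det =
      ∏ j ∈ Finset.range (N + 1), (x + ((N : ℝ) - 2 * (j : ℝ)) * a - (N : ℝ) + (j : ℝ)) := by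
  rw [Matrix.det_of_isLowerTriangular, ← Fin.prod_univ_eq_prod_range
    (fun j => x + ((N : ℝ) - 2 * (j : ℝ)) * a - (N : ℝ) + (j : ℝ))]
  · simp [askeyBidiag]
  · intro i k hik
    have hik' : (i : ℕ) < k := hik
    simp [askeyBidiag, show (i : ℕ) ≠ k by omega, show (i : ℕ) ≠ (k : ℕ) + 1 by omega]

theorem succ_mul_oneSubPowCoeff_succ (i k : ℕ) :
    ((i : ℝ) + 1) * oneSubPowCoeff (i + 1) k = ((i : ℝ) - k) * oneSubPowCoeff i k := by
  have h : ((k.choose (i + 1) : ℝ)) * (i + 1) = k.choose i * ((k : ℝ) - i) := by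
    rcases le_or_gt i k with hik | hik
    · have := Nat.choose_succ_right_eq k i
      rw [← Nat.cast_sub hik]
      exact_mod_cast this
    · simp [Nat.choose_eq_zero_of_lt hik, Nat.choose_eq_zero_of_lt (Nat.lt_succ_of_lt hik)]
  simp only [oneSubPowCoeff, pow_succ]
  linear_combination (-(-1) ^ i) * h

theorem oneSubPowCoeff_succ_succ (i k : ℕ) :
    oneSubPowCoeff (i + 1) (k + 1) = oneSubPowCoeff (i + 1) k - oneSubPowCoeff i k := by
  simp only [oneSubPowCoeff, pow_succ, Nat.choose_succ_succ', Nat.cast_add]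
  ring

theorem askeyB_mul_oneSubPowMatrix_apply (N : ℕ) (a : ℝ) (i k : Fin (N + 1)) :
    (askeyB (N + 1) a * oneSubPowMatrix (N + 1)) i k =
      ((i : ℕ) + 1 : ℝ) * a * oneSubPowCoeff (i + 1) k - (i : ℕ) * oneSubPowCoeff i k +
        if (i : ℕ) = 0 then 0
        else ((N : ℝ) + 1 - (i : ℕ)) * (a - 1) * oneSubPowCoeff (i - 1) k := by
  obtain ⟨i, hi⟩ := i
  obtain ⟨k, hk⟩ := k
  have hsplit : ∑ j : Fin (N + 1),
      askeyB (N + 1) a ⟨i, hi⟩ j * oneSubPowMatrix (N + 1) j ⟨k, hk⟩ =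
      ∑ j ∈ Finset.range (N + 1), ((if i + 1 = j then ((i : ℝ) + 1) * a * oneSubPowCoeff j k else 0) -
        (if i = j then (i : ℝ) * oneSubPowCoeff j k else 0) +
        (if i = j + 1 then ((N : ℝ) + 1 - i) * (a - 1) * oneSubPowCoeff j k else 0)) := by
    rw [← Fin.sum_univ_eq_sum_range]
    refine Finset.sum_congr rfl ?_
    rintro ⟨j, hj⟩ -
    simp only [askeyB, oneSubPowMatrix, Matrix.of_apply, Fin.mk.injEq, Nat.cast_add, Nat.cast_one]
    split_ifs <;> first | omega | ring
  rw [Matrix.mul_apply, hsplit,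
    Finset.sum_add_distrib, Finset.sum_sub_distrib, Finset.sum_ite_eq, Finset.sum_ite_eq,
    if_pos (Finset.mem_range.mpr hi)]
  congr 1
  · congr 1
    split_ifs with h
    · rfl
    · have : k < i + 1 := by simp at h; omega
      simp [oneSubPowCoeff, Nat.choose_eq_zero_of_lt this]
  · rcases i with _ | m
    · simp
    · have : m < N + 1 := by omega
      simp only [add_left_inj, Finset.sum_ite_eq, Finset.mem_range, if_pos this]
      simp

theorem oneSubPowMatrix_mul_askeyBidiag_apply (N : ℕ) (a x : ℝ) (i k : Fin (N + 1)) :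
    (oneSubPowMatrix (N + 1) * askeyBidiag N a x) i k =
      (x + ((N : ℝ) - 2 * ((k : ℕ) : ℝ)) * a - N + (k : ℕ)) * oneSubPowCoeff i k +
        (((k : ℕ) : ℝ) - N) * (a - 1) * oneSubPowCoeff i (k + 1) := by
  obtain ⟨i, hi⟩ := i
  obtain ⟨k, hk⟩ := k
  have hsplit : ∑ j : Fin (N + 1),
      oneSubPowMatrix (N + 1) ⟨i, hi⟩ j * askeyBidiag N a x j ⟨k, hk⟩ =
      ∑ j ∈ Finset.range (N + 1),
        ((if k = j then (x + ((N : ℝ) - 2 * (k : ℝ)) * a - N + k) * oneSubPowCoeff i j else 0) +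
        (if k + 1 = j then ((k : ℝ) - N) * (a - 1) * oneSubPowCoeff i j else 0)) := by
    rw [← Fin.sum_univ_eq_sum_range]
    refine Finset.sum_congr rfl ?_
    rintro ⟨j, hj⟩ -
    simp only [askeyBidiag, oneSubPowMatrix, Matrix.of_apply]
    split_ifs <;> first | omega | ring
  rw [Matrix.mul_apply, hsplit,
    Finset.sum_add_distrib, Finset.sum_ite_eq, Finset.sum_ite_eq,
    if_pos (Finset.mem_range.mpr hk)]
  congr 1
  split_ifs with h
  · rfl
  · have : k = N := by simp at h; omega
    simp [this]

theorem askeyB_mul_oneSubPowMatrix (N : ℕ) (a x : ℝ) :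
    (x • (1 : Matrix (Fin (N + 1)) (Fin (N + 1)) ℝ) + askeyB (N + 1) a) *
      oneSubPowMatrix (N + 1) = oneSubPowMatrix (N + 1) * askeyBidiag N a x := by
  ext i k
  rw [oneSubPowMatrix_mul_askeyBidiag_apply, Matrix.add_mul, Matrix.add_apply,
    askeyB_mul_oneSubPowMatrix_apply, Matrix.smul_mul, Matrix.one_mul, Matrix.smul_apply]
  obtain ⟨i, hi⟩ := i
  obtain ⟨k, hk⟩ := k
  simp only [oneSubPowMatrix, Matrix.of_apply, smul_eq_mul]
  have h := succ_mul_oneSubPowCoeff_succ i k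
  rcases i with _ | m
  · have h0 : ∀ l, oneSubPowCoeff 0 l = 1 := fun l => by simp [oneSubPowCoeff]
    simp only [h0, Nat.cast_zero] at h ⊢
    simp only [if_true]
    linear_combination a * h
  · have h' := succ_mul_oneSubPowCoeff_succ m k
    simp only [oneSubPowCoeff_succ_succ, Nat.add_eq_zero_iff, one_ne_zero, and_false, if_false,
      Nat.add_sub_cancel, Nat.cast_add, Nat.cast_one] at h ⊢
    linear_combination a * h + (a - 1) * h'

theorem askeyB_det (N : ℕ) (a : ℝ) (x : ℝ) :
    (x • (1 : Matrix (Fin (N + 1)) (Fin (N + 1)) ℝ) + askeyB (N + 1) a).det =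
      ∏ j ∈ Finset.range (N + 1), (x + ((N : ℝ) - 2 * (j : ℝ)) * a - (N : ℝ) + (j : ℝ)) := by
  have h := congrArg Matrix.det (askeyB_mul_oneSubPowMatrix N a x)
  rw [Matrix.det_mul, Matrix.det_mul, mul_comm, askeyBidiag_det] at h
  exact mul_left_cancel₀ (oneSubPowMatrix_det_ne_zero _) h
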